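/- Let X and Y be discrete random variables taking values in a finite set 𝒳 and in 𝒴 = {-1,1} respectively, with joint distribution P, and let f : 𝒳 → 𝒵 with F = f(X). If there exist x₁, x₂ in the support of P_X with f(x₁) = f(x₂) but P(Y=1|X=x₁) ≠ P(Y=1|X=x₂), then I_P(F;Y) < I_P(X;Y), i.e., f is not lossless. In particular, any model assigning the same score to an unambiguously labelled point (P(Y=1|X=x₁) = 1) and to an ambiguously labelled point (0.5 < P(Y=1|X=x₂) < 1) fails to be lossless. -/

import Mathlib

open Finset

noncomputable section

/-- The binary label space `𝒴 = {-1, 1} ⊆ ℤ`. -/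
abbrev Ybin : Type := ({-1, 1} : Finset ℤ)

/-- The label `+1` as an element of `Ybin`. -/
def yPos : Ybin := ⟨1, by decide⟩

/-- The label `-1` as an element of `Ybin`. -/
def yNeg : Ybin := ⟨-1, by decide⟩

/-- Probability of a set under a finitely supported pmf `P`. -/
def pr {Ω : Type*} [Fintype Ω] (P : Ω → ℝ) (s : Set Ω) : ℝ :=
  ∑ ω, s.indicator P ω

/-- Entropy `H_P(A)` of a random variable `A` (a function of the sample point),
`H_P(A) = -∑_a P(A=a) log P(A=a)`, written as a sum over sample points. -/
def ent {Ω α : Type*} [Fintype Ω] (P : Ω → ℝ) (A : Ω → α) : ℝ :=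
  -∑ ω, P ω * Real.log (pr P {ω' | A ω' = A ω})

/-- Conditional entropy `H_P(A|B) = -∑_{a,b} P(A=a,B=b) log P(A=a|B=b)`. -/
def condEnt {Ω α β : Type*} [Fintype Ω] (P : Ω → ℝ) (A : Ω → α) (B : Ω → β) : ℝ :=
  -∑ ω, P ω * Real.log (pr P {ω' | A ω' = A ω ∧ B ω' = B ω} / pr P {ω' | B ω' = B ω})

/-- Mutual information `I_P(A;B) = ∑_{a,b} P(A=a,B=b) log (P(A=a,B=b) / (P(A=a) P(B=b)))`. -/
def mi {Ω α β : Type*} [Fintype Ω] (P : Ω → ℝ) (A : Ω → α) (B : Ω → β) : ℝ :=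
  ∑ ω, P ω * Real.log (pr P {ω' | A ω' = A ω ∧ B ω' = B ω} /
      (pr P {ω' | A ω' = A ω} * pr P {ω' | B ω' = B ω}))

/-- Marginal `P_X(x) = ∑_y P(x,y)`. -/
def margX {𝒳 : Type*} [Fintype 𝒳] (P : 𝒳 × Ybin → ℝ) (x : 𝒳) : ℝ :=
  ∑ y, P (x, y)

/-- Risk `R_P(h) = P[sign(h(X)) ≠ Y]`. -/
def risk {𝒳 : Type*} [Fintype 𝒳] (P : 𝒳 × Ybin → ℝ) (h : 𝒳 → ℝ) : ℝ :=
  pr P {ω | Real.sign (h ω.1) ≠ ((ω.2 : ℤ) : ℝ)}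

lemma pr_mono {Ω : Type*} [Fintype Ω] {P : Ω → ℝ} (hP : ∀ ω, 0 ≤ P ω) {s t : Set Ω}
    (hst : s ⊆ t) : pr P s ≤ pr P t :=
  Finset.sum_le_sum fun ω _ => Set.indicator_le_indicator_of_subset hst hP ω

lemma pr_singleton {Ω : Type*} [Fintype Ω] (P : Ω → ℝ) (ω : Ω) : pr P {ω} = P ω := by
  classical
  simp [pr, Set.indicator_apply]

/-- The probability of an event is the sum of its joint probabilities with the values of a
finitely valued random variable. -/
lemma sum_pr_inter_eq {Ω β : Type*} [Fintype Ω] [Fintype β] (P : Ω → ℝ) (s : Set Ω)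
    (B : Ω → β) : ∑ b, pr P {ω | ω ∈ s ∧ B ω = b} = pr P s := by
  classical
  unfold pr
  rw [Finset.sum_comm]
  refine Finset.sum_congr rfl fun ω _ => ?_
  by_cases h : ω ∈ s <;> simp [Set.indicator_apply, h]

lemma pr_joint_eq {𝒳 : Type*} [Fintype 𝒳] (P : 𝒳 × Ybin → ℝ) (ω : 𝒳 × Ybin) :
    pr P {ω' | ω'.1 = ω.1 ∧ ω'.2 = ω.2} = P ω := by
  rw [← pr_singleton P ω]
  congr 1
  ext ω'
  simp [Prod.ext_iff]

lemma pr_fst_eq_margX {𝒳 : Type*} [Fintype 𝒳] (P : 𝒳 × Ybin → ℝ) (x : 𝒳) :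
    pr P {ω | ω.1 = x} = margX P x := by
  rw [← sum_pr_inter_eq P _ Prod.snd]
  exact Finset.sum_congr rfl fun y _ => pr_joint_eq P (x, y)

/-- The pointwise form of the log-sum inequality, in its strict form. -/
lemma mul_log_div_add_lt {p m j M q : ℝ} (hp : 0 ≤ p) (hpm : p ≤ m) (hpj : p ≤ j)
    (hjM : j ≤ M) (hjq : j ≤ q) (hne : p ≠ m * j / M) :
    p * Real.log (j / (M * q)) + (p - m * j / M) < p * Real.log (p / (m * q)) := by
  rcases hp.eq_or_lt with rfl | hp
  · have : 0 ≤ m * j / M := div_nonneg (mul_nonneg hpm hpj) (hpj.trans hjM)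
    have := this.lt_of_ne hne
    simpa using this
  · have hm : 0 < m := by linarith
    have hj : 0 < j := by linarith
    have hM : 0 < M := by linarith
    have hq : 0 < q := by linarith
    have ht : 0 < m * j / M / p := by positivity
    have hlog := Real.log_lt_sub_one_of_pos ht
      (fun h => hne ((div_eq_one_iff_eq hp.ne').1 h).symm)
    have hsplit : Real.log (j / (M * q)) =
        Real.log (p / (m * q)) + Real.log (m * j / M / p) := by
      rw [← Real.log_mul (by positivity) (by positivity)]
      congr 1
      field_simp
    have hmul := mul_lt_mul_of_pos_left hlog hp
    have hcancel : p * (m * j / M / p - 1) = m * j / M - p := by field_simp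
    rw [hsplit, mul_add]
    linarith

/-- The pointwise form of the log-sum inequality. -/
lemma mul_log_div_add_le {p m j M q : ℝ} (hp : 0 ≤ p) (hpm : p ≤ m) (hpj : p ≤ j)
    (hjM : j ≤ M) (hjq : j ≤ q) :
    p * Real.log (j / (M * q)) + (p - m * j / M) ≤ p * Real.log (p / (m * q)) := by
  by_cases hne : p = m * j / M
  · rcases hp.eq_or_lt with rfl | hp
    · simp [← hne]
    · have hm : 0 < m := by linarith
      have hM : 0 < M := by linarith
      have hq : 0 < q := by linarith
      have h : p / (m * q) = j / (M * q) := by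
        rw [hne]
        field_simp
      rw [h, ← hne]
      simp
  · exact (mul_log_div_add_lt hp hpm hpj hjM hjq hne).le

/-- If `x₁, x₂` lie in the support of `P_X`, `f x₁ = f x₂`, but
`P(Y=1|X=x₁) ≠ P(Y=1|X=x₂)`, then `I_P(F;Y) < I_P(X;Y)`: `f` is not lossless. -/
theorem not_lossless_of_merging_distinct_condProb {𝒳 𝒵 : Type*} [Fintype 𝒳]
    (P : 𝒳 × Ybin → ℝ) (hP0 : ∀ ω, 0 ≤ P ω) (hP1 : ∑ ω, P ω = 1)
    (f : 𝒳 → 𝒵) (x₁ x₂ : 𝒳) (hx₁ : 0 < margX P x₁) (hx₂ : 0 < margX P x₂)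
    (hfx : f x₁ = f x₂)
    (hcond : P (x₁, yPos) / margX P x₁ ≠ P (x₂, yPos) / margX P x₂) :
    mi P (fun ω => f ω.1) (fun ω => ω.2) < mi P (fun ω => ω.1) (fun ω => ω.2) := by
  set J : 𝒵 → Ybin → ℝ := fun z y => pr P {ω | f ω.1 = z ∧ ω.2 = y}
  set M : 𝒵 → ℝ := fun z => pr P {ω | f ω.1 = z}
  have hpm (ω : 𝒳 × Ybin) : P ω ≤ margX P ω.1 :=
    Finset.single_le_sum (f := fun y => P (ω.1, y)) (fun y _ => hP0 _) (Finset.mem_univ ω.2)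
  have hpj (ω : 𝒳 × Ybin) : P ω ≤ J (f ω.1) ω.2 := by
    rw [← pr_joint_eq P ω]
    exact pr_mono hP0 fun ω' h => ⟨congrArg f h.1, h.2⟩
  have hjM (ω : 𝒳 × Ybin) : J (f ω.1) ω.2 ≤ M (f ω.1) := pr_mono hP0 fun _ h => h.1
  have hjq (ω : 𝒳 × Ybin) : J (f ω.1) ω.2 ≤ pr P {ω' | ω'.2 = ω.2} :=
    pr_mono hP0 fun _ h => h.2
  have hmM (x : 𝒳) : margX P x ≤ M (f x) := by
    rw [← pr_fst_eq_margX]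
    exact pr_mono hP0 fun ω h => congrArg f h
  have hsumJ (z : 𝒵) : ∑ y, J z y = M z := sum_pr_inter_eq P {ω | f ω.1 = z} Prod.snd
  have hm0 (x : 𝒳) : 0 ≤ margX P x := Finset.sum_nonneg fun y _ => hP0 _
  have hzero : ∑ ω : 𝒳 × Ybin, (P ω - margX P ω.1 * J (f ω.1) ω.2 / M (f ω.1)) = 0 := by
    rw [Fintype.sum_prod_type]
    refine Finset.sum_eq_zero fun x _ => ?_
    dsimp only
    rw [Finset.sum_sub_distrib, ← Finset.sum_div, ← Finset.mul_sum, hsumJ, sub_eq_zero]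
    change margX P x = _
    by_cases h : M (f x) = 0
    · have := hm0 x
      have := hmM x
      rw [h, div_zero]
      linarith
    · field_simp
  have hstrict : ∃ ω : 𝒳 × Ybin, P ω ≠ margX P ω.1 * J (f ω.1) ω.2 / M (f ω.1) := by
    by_contra! h
    refine hcond ?_
    rw [h (x₁, yPos), h (x₂, yPos)]
    simp only [hfx]
    field_simp
  obtain ⟨ω₀, hω₀⟩ := hstrict
  have hlt := Finset.sum_lt_sum
    (fun ω _ => mul_log_div_add_le (hP0 ω) (hpm ω) (hpj ω) (hjM ω) (hjq ω))
    ⟨ω₀, Finset.mem_univ ω₀,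
      mul_log_div_add_lt (hP0 ω₀) (hpm ω₀) (hpj ω₀) (hjM ω₀) (hjq ω₀) hω₀⟩
  rw [Finset.sum_add_distrib, hzero, add_zero] at hlt
  simpa only [mi, pr_joint_eq, pr_fst_eq_margX] using hlt
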